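/- arXiv:1711.06137 — 2 statements merged into one kernel-verified Lean document; each statement's English description precedes it below -/
import Mathlib

section
/- The maximum possible number of triangles over all simple graphs with degree sequence (4,4,3,3,3,2,1) is 5, and there is an execution of the Havel–Hakimi construction on this sequence producing a graph with only 3 triangles. -/
/-- The number of triangles (3-cliques) of a simple graph. -/
noncomputable def triangleCount {V : Type*} (G : SimpleGraph V) : ℕ :=
  {t : Finset V | G.IsNClique 3 t}.ncard

/-- `HHBuild d G` means that the simple graph `G` is producible by some
execution of the Havel–Hakimi construction on the residual degree sequence
`d`: repeatedly, a vertex `v` of maximal residual degree is connected to a set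
`S` of `d v` other vertices of next-highest residual degrees (ties broken
arbitrarily), whose residual degrees are then reduced by one. -/
inductive HHBuild {n : ℕ} : (Fin n → ℕ) → SimpleGraph (Fin n) → Prop
  | base : HHBuild (fun _ => 0) ⊥
  | step (d : Fin n → ℕ) (v : Fin n) (S : Finset (Fin n)) (G : SimpleGraph (Fin n))
      (hmax : ∀ w, d w ≤ d v)
      (hv : v ∉ S)
      (hcard : S.card = d v)
      (hpos : ∀ a ∈ S, 1 ≤ d a)
      (hbest : ∀ a ∈ S, ∀ b, b ≠ v → b ∉ S → d b ≤ d a)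
      (hiso : ∀ a, ¬ G.Adj v a)
      (hrec : HHBuild (fun w => if w = v then 0 else if w ∈ S then d w - 1 else d w) G) :
      HHBuild d (G ⊔ SimpleGraph.fromEdgeSet (↑(S.image fun a => s(v, a))))

set_option maxRecDepth 100000 in
set_option maxHeartbeats 0 in
theorem aux_bool : ∀ b01 b02 b03 b04 b05 b06 : Bool,
  b01.toNat + b02.toNat + b03.toNat + b04.toNat + b05.toNat + b06.toNat = 4 →
  ∀ b12 b13 b14 b15 b16 : Bool,
  b01.toNat + b12.toNat + b13.toNat + b14.toNat + b15.toNat + b16.toNat = 4 →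
  ∀ b23 b24 b25 b26 : Bool,
  b02.toNat + b12.toNat + b23.toNat + b24.toNat + b25.toNat + b26.toNat = 3 →
  ∀ b34 b35 b36 : Bool,
  b03.toNat + b13.toNat + b23.toNat + b34.toNat + b35.toNat + b36.toNat = 3 →
  ∀ b45 b46 : Bool,
  b04.toNat + b14.toNat + b24.toNat + b34.toNat + b45.toNat + b46.toNat = 3 →
  ∀ b56 : Bool,
  b05.toNat + b15.toNat + b25.toNat + b35.toNat + b45.toNat + b56.toNat = 2 →
  b06.toNat + b16.toNat + b26.toNat + b36.toNat + b46.toNat + b56.toNat = 1 →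
  (b01 && b02 && b12).toNat + (b01 && b03 && b13).toNat + (b01 && b04 && b14).toNat + (b01 && b05 && b15).toNat + (b01 && b06 && b16).toNat + (b02 && b03 && b23).toNat + (b02 && b04 && b24).toNat + (b02 && b05 && b25).toNat + (b02 && b06 && b26).toNat + (b03 && b04 && b34).toNat + (b03 && b05 && b35).toNat + (b03 && b06 && b36).toNat + (b04 && b05 && b45).toNat + (b04 && b06 && b46).toNat + (b05 && b06 && b56).toNat + (b12 && b13 && b23).toNat + (b12 && b14 && b24).toNat + (b12 && b15 && b25).toNat + (b12 && b16 && b26).toNat + (b13 && b14 && b34).toNat + (b13 && b15 && b35).toNat + (b13 && b16 && b36).toNat + (b14 && b15 && b45).toNat + (b14 && b16 && b46).toNat + (b15 && b16 && b56).toNat + (b23 && b24 && b34).toNat + (b23 && b25 && b35).toNat + (b23 && b26 && b36).toNat + (b24 && b25 && b45).toNat + (b24 && b26 && b46).toNat + (b25 && b26 && b56).toNat + (b34 && b35 && b45).toNat + (b34 && b36 && b46).toNat + (b35 && b36 && b56).toNat + (b45 && b46 && b56).toNat ≤ 5 := by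
  decide

def gOf (E : Finset (Sym2 (Fin 7))) : SimpleGraph (Fin 7) :=
  SimpleGraph.fromEdgeSet (E : Set (Sym2 (Fin 7)))

instance gOfDec (E : Finset (Sym2 (Fin 7))) : DecidableRel (gOf E).Adj := fun a b =>
  decidable_of_iff (s(a, b) ∈ E ∧ a ≠ b) (by simp [gOf])

theorem ncard_nbr (G : SimpleGraph (Fin 7)) [DecidableRel G.Adj] (i : Fin 7) :
    (G.neighborSet i).ncard = ∑ j, (decide (G.Adj i j)).toNat := by
  have : G.neighborSet i = ((Finset.univ.filter fun j => G.Adj i j : Finset (Fin 7)) : Set (Fin 7)) := by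
    ext j; simp
  rw [this, Set.ncard_coe_finset, Finset.card_filter]
  refine Finset.sum_congr rfl fun j _ => ?_
  by_cases h : G.Adj i j <;> simp [h]

theorem tri_card (G : SimpleGraph (Fin 7)) [DecidableRel G.Adj] :
    triangleCount G = (Finset.univ.filter fun p : Fin 7 × Fin 7 × Fin 7 =>
      p.1 < p.2.1 ∧ p.2.1 < p.2.2 ∧ G.Adj p.1 p.2.1 ∧ G.Adj p.1 p.2.2 ∧ G.Adj p.2.1 p.2.2).card := by
  rw [← Set.ncard_coe_finset, triangleCount]
  symm
  refine Set.ncard_congr (fun p _ => {p.1, p.2.1, p.2.2}) ?_ ?_ ?_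
  · rintro ⟨a, b, c⟩ h
    simp only [Finset.coe_filter, Finset.mem_univ, true_and, Set.mem_setOf_eq] at h
    simp only [Set.mem_setOf_eq, SimpleGraph.is3Clique_triple_iff]
    tauto
  · rintro ⟨a, b, c⟩ ⟨a', b', c'⟩ h h' e
    simp only [Finset.coe_filter, Finset.mem_univ, true_and, Set.mem_setOf_eq] at h h'
    obtain ⟨h1, h2, -⟩ := h
    obtain ⟨h1', h2', -⟩ := h'
    simp only at e
    have ea : ∀ x, (x = a ∨ x = b ∨ x = c) ↔ (x = a' ∨ x = b' ∨ x = c') := fun x => by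
      simpa using Finset.ext_iff.1 e x
    have := (ea a).1 (by simp)
    have := (ea b).1 (by simp)
    have := (ea c).1 (by simp)
    have := (ea a').2 (by simp)
    simp only [Prod.mk.injEq]
    omega
  · intro t ht
    obtain ⟨a, b, c, hab, hac, hbc, rfl⟩ := SimpleGraph.is3Clique_iff.1 ht
    have key : ∀ x y z : Fin 7, x < y → y < z → G.Adj x y → G.Adj x z → G.Adj y z →
        ({x, y, z} : Finset (Fin 7)) = {a, b, c} → ∃ p, ∃ (_ : p ∈ ((Finset.univ.filter
          fun p : Fin 7 × Fin 7 × Fin 7 => p.1 < p.2.1 ∧ p.2.1 < p.2.2 ∧ G.Adj p.1 p.2.1 ∧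
          G.Adj p.1 p.2.2 ∧ G.Adj p.2.1 p.2.2 : Finset _) : Set (Fin 7 × Fin 7 × Fin 7))),
          ({p.1, p.2.1, p.2.2} : Finset (Fin 7)) = {a, b, c} := by
      intro x y z h1 h2 h3 h4 h5 h6
      exact ⟨(x, y, z), by simp [h1, h2, h3, h4, h5], h6⟩
    rcases lt_or_gt_of_ne hab.ne with h1 | h1 <;> rcases lt_or_gt_of_ne hac.ne with h2 | h2 <;>
      rcases lt_or_gt_of_ne hbc.ne with h3 | h3
    · exact key a b c h1 h3 hab hac hbc rfl
    · exact key a c b h2 h3 hac hab hbc.symm (by ext; simp; tauto)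
    · omega
    · exact key c a b h2 h1 hac.symm hbc.symm hab (by ext; simp; tauto)
    · exact key b a c h1 h2 hab.symm hbc hac (by ext; simp; tauto)
    · omega
    · exact key b c a h3 h2 hbc hab.symm hac.symm (by ext; simp; tauto)
    · exact key c b a h3 h1 hbc.symm hac.symm hab.symm (by ext; simp; tauto)

theorem tri_sum (G : SimpleGraph (Fin 7)) [DecidableRel G.Adj] :
    triangleCount G = ∑ i : Fin 7, ∑ j : Fin 7, ∑ k : Fin 7, if i < j ∧ j < k then
      (decide (G.Adj i j) && decide (G.Adj i k) && decide (G.Adj j k)).toNat else 0 := by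
  rw [tri_card, Finset.card_filter, Fintype.sum_prod_type]
  refine Finset.sum_congr rfl fun i _ => ?_
  rw [Fintype.sum_prod_type]
  refine Finset.sum_congr rfl fun j _ => Finset.sum_congr rfl fun k _ => ?_
  by_cases h1 : i < j <;> by_cases h2 : j < k <;> by_cases h3 : G.Adj i j <;>
    by_cases h4 : G.Adj i k <;> by_cases h5 : G.Adj j k <;> simp [h1, h2, h3, h4, h5]

theorem hh_step {d d' : Fin 7 → ℕ} (v : Fin 7) (S : Finset (Fin 7)) (E E' : Finset (Sym2 (Fin 7)))
    (h : HHBuild d' (gOf E))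
    (hmax : ∀ w, d w ≤ d v) (hv : v ∉ S) (hcard : S.card = d v)
    (hpos : ∀ a ∈ S, 1 ≤ d a) (hbest : ∀ a ∈ S, ∀ b, b ≠ v → b ∉ S → d b ≤ d a)
    (hiso : ∀ a, ¬ (gOf E).Adj v a)
    (hd : ∀ w, (if w = v then 0 else if w ∈ S then d w - 1 else d w) = d' w)
    (hE : E ∪ S.image (fun a => s(v, a)) = E') : HHBuild d (gOf E') := by
  obtain rfl : _ = d' := funext hd
  have := HHBuild.step d v S (gOf E) hmax hv hcard hpos hbest hiso h
  rwa [gOf, ← SimpleGraph.fromEdgeSet_union, ← Finset.coe_union, hE] at this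

theorem hh_c : HHBuild (![4, 4, 3, 3, 3, 2, 1] : Fin 7 → ℕ)
    (gOf {s(0, 1), s(0, 2), s(0, 3), s(0, 4), s(1, 2), s(1, 3), s(1, 4), s(5, 2), s(5, 3), s(4, 6)}) := by
  have h0 : HHBuild (![0, 0, 0, 0, 0, 0, 0] : Fin 7 → ℕ) (gOf ∅) := by
    have e : (![0, 0, 0, 0, 0, 0, 0] : Fin 7 → ℕ) = fun _ => 0 := by decide
    have := HHBuild.base (n := 7)
    rw [e]
    simpa [gOf] using this
  have h1 : HHBuild (![0, 0, 0, 0, 1, 0, 1] : Fin 7 → ℕ) (gOf {s(4, 6)}) := by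
    apply hh_step 4 {6} _ _ h0 <;> decide
  have h2 : HHBuild (![0, 0, 1, 1, 1, 2, 1] : Fin 7 → ℕ) (gOf {s(5, 2), s(5, 3), s(4, 6)}) := by
    apply hh_step 5 {2, 3} _ _ h1 <;> decide
  have h3 : HHBuild (![0, 3, 2, 2, 2, 2, 1] : Fin 7 → ℕ) (gOf {s(1, 2), s(1, 3), s(1, 4), s(5, 2), s(5, 3), s(4, 6)}) := by
    apply hh_step 1 {2, 3, 4} _ _ h2 <;> decide
  apply hh_step 0 {1, 2, 3, 4} _ _ h3 <;> decide

set_option maxHeartbeats 0 in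
theorem part_a (G : SimpleGraph (Fin 7))
    (hG : ∀ i, (G.neighborSet i).ncard = (![4, 4, 3, 3, 3, 2, 1] : Fin 7 → ℕ) i) :
    triangleCount G ≤ 5 := by
  classical
  rw [tri_sum]
  have hd := hG
  simp only [ncard_nbr] at hd
  set f : Fin 7 → Fin 7 → Bool := fun i j => decide (G.Adj i j) with hf
  have hs : ∀ i j, f i j = f j i := fun i j => by simp [hf, G.adj_comm]
  have hl : ∀ i, f i i = false := fun i => by simp [hf]
  change ∑ i : Fin 7, ∑ j : Fin 7, ∑ k : Fin 7, (if i < j ∧ j < k then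
      (f i j && f i k && f j k).toNat else 0) ≤ 5
  replace hd : ∀ i, ∑ j, (f i j).toNat = (![4, 4, 3, 3, 3, 2, 1] : Fin 7 → ℕ) i := hd
  clear_value f
  have d0 := hd 0
  have d1 := hd 1
  have d2 := hd 2
  have d3 := hd 3
  have d4 := hd 4
  have d5 := hd 5
  have d6 := hd 6
  rw [Fin.sum_univ_seven] at d0 d1 d2 d3 d4 d5 d6
  replace d0 : (f 0 1).toNat + (f 0 2).toNat + (f 0 3).toNat + (f 0 4).toNat + (f 0 5).toNat + (f 0 6).toNat = 4 := by
    simpa [hl] using d0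
  replace d1 : (f 0 1).toNat + (f 1 2).toNat + (f 1 3).toNat + (f 1 4).toNat + (f 1 5).toNat + (f 1 6).toNat = 4 := by
    simpa [hl, hs 1 0] using d1
  replace d2 : (f 0 2).toNat + (f 1 2).toNat + (f 2 3).toNat + (f 2 4).toNat + (f 2 5).toNat + (f 2 6).toNat = 3 := by
    simpa [hl, hs 2 0, hs 2 1] using d2
  replace d3 : (f 0 3).toNat + (f 1 3).toNat + (f 2 3).toNat + (f 3 4).toNat + (f 3 5).toNat + (f 3 6).toNat = 3 := by
    simpa [hl, hs 3 0, hs 3 1, hs 3 2] using d3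
  replace d4 : (f 0 4).toNat + (f 1 4).toNat + (f 2 4).toNat + (f 3 4).toNat + (f 4 5).toNat + (f 4 6).toNat = 3 := by
    simpa [hl, hs 4 0, hs 4 1, hs 4 2, hs 4 3] using d4
  replace d5 : (f 0 5).toNat + (f 1 5).toNat + (f 2 5).toNat + (f 3 5).toNat + (f 4 5).toNat + (f 5 6).toNat = 2 := by
    simpa [hl, hs 5 0, hs 5 1, hs 5 2, hs 5 3, hs 5 4] using d5
  replace d6 : (f 0 6).toNat + (f 1 6).toNat + (f 2 6).toNat + (f 3 6).toNat + (f 4 6).toNat + (f 5 6).toNat = 1 := by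
    simpa [hl, hs 6 0, hs 6 1, hs 6 2, hs 6 3, hs 6 4, hs 6 5] using d6
  have := aux_bool (f 0 1) (f 0 2) (f 0 3) (f 0 4) (f 0 5) (f 0 6) d0 (f 1 2) (f 1 3) (f 1 4) (f 1 5) (f 1 6) d1 (f 2 3) (f 2 4) (f 2 5) (f 2 6) d2 (f 3 4) (f 3 5) (f 3 6) d3 (f 4 5) (f 4 6) d4 (f 5 6) d5  d6
  refine le_trans (le_of_eq ?_) this
  simp [Fin.sum_univ_seven]
  try ring

/-- For the degree sequence `(4,4,3,3,3,2,1)`: (a) every realizing simple graph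
has at most 5 triangles, (b) some realizing graph has exactly 5 triangles, and
(c) some graph obtainable by a valid Havel–Hakimi execution on this sequence
has exactly 3 triangles. -/
theorem havel_hakimi_not_triangle_maximal :
    (∀ G : SimpleGraph (Fin 7),
        (∀ i, (G.neighborSet i).ncard = (![4, 4, 3, 3, 3, 2, 1] : Fin 7 → ℕ) i) →
        triangleCount G ≤ 5) ∧
    (∃ G : SimpleGraph (Fin 7),
        (∀ i, (G.neighborSet i).ncard = (![4, 4, 3, 3, 3, 2, 1] : Fin 7 → ℕ) i) ∧
        triangleCount G = 5) ∧
    (∃ G : SimpleGraph (Fin 7),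
        HHBuild (![4, 4, 3, 3, 3, 2, 1] : Fin 7 → ℕ) G ∧
        (∀ i, (G.neighborSet i).ncard = (![4, 4, 3, 3, 3, 2, 1] : Fin 7 → ℕ) i) ∧
        triangleCount G = 3) := by
  refine ⟨part_a, ⟨gOf {s(0, 1), s(0, 2), s(0, 3), s(1, 2), s(1, 3), s(2, 3), s(0, 4), s(1, 4), s(4, 5), s(5, 6)}, ?_, ?_⟩, ⟨_, hh_c, ?_, ?_⟩⟩
  · simp only [ncard_nbr]; decide
  · rw [tri_sum]; decide +kernel
  · simp only [ncard_nbr]; decide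
  · rw [tri_sum]; decide +kernel
end

section
/- If two nonincreasing graphical degree sequences on n vertices are realized by simple graphs G and H, and the sequences are equal, then H can be obtained from G by a finite sequence of switches (the switch chain is irreducible on graphs with a fixed degree sequence). -/
/-- `SwitchStep G H` means the simple graph `H` is obtained from `G` by one
switch: edges `u1v1`, `u2v2` on four distinct vertices are replaced by the
non-edges `u1v2`, `u2v1`. -/
def SwitchStep {V : Type*} (G H : SimpleGraph V) : Prop :=
  ∃ u1 v1 u2 v2 : V,
    u1 ≠ v1 ∧ u1 ≠ u2 ∧ u1 ≠ v2 ∧ v1 ≠ u2 ∧ v1 ≠ v2 ∧ u2 ≠ v2 ∧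
    G.Adj u1 v1 ∧ G.Adj u2 v2 ∧ ¬ G.Adj u1 v2 ∧ ¬ G.Adj u2 v1 ∧
    H = SimpleGraph.fromEdgeSet
      ((G.edgeSet \ {s(u1, v1), s(u2, v2)}) ∪ {s(u1, v2), s(u2, v1)})

open Classical in
noncomputable def dS {V : Type*} (S : Finset V) (G : SimpleGraph V) (x : V) : ℕ :=
  (S.filter (fun y => G.Adj x y)).card

def sw {V : Type*} (G : SimpleGraph V) (u1 v1 u2 v2 : V) : SimpleGraph V :=
  SimpleGraph.fromEdgeSet
      ((G.edgeSet \ {s(u1, v1), s(u2, v2)}) ∪ {s(u1, v2), s(u2, v1)})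

theorem sw_adj {V : Type*} (G : SimpleGraph V) (u1 v1 u2 v2 : V)
    (h1 : u1 ≠ v2) (h2 : u2 ≠ v1) (x y : V) :
    (sw G u1 v1 u2 v2).Adj x y ↔
      (G.Adj x y ∧ ¬ (x = u1 ∧ y = v1) ∧ ¬ (x = v1 ∧ y = u1) ∧ ¬ (x = u2 ∧ y = v2)
        ∧ ¬ (x = v2 ∧ y = u2)) ∨ (x = u1 ∧ y = v2) ∨ (x = v2 ∧ y = u1) ∨
        (x = u2 ∧ y = v1) ∨ (x = v1 ∧ y = u2) := by
  have := G.ne_of_adj (a := x) (b := y)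
  simp only [sw, SimpleGraph.fromEdgeSet_adj, Set.mem_union, Set.mem_sdiff,
    SimpleGraph.mem_edgeSet, Set.mem_insert_iff, Set.mem_singleton_iff, Sym2.eq_iff]
  grind

theorem SwitchStep.symm' {V : Type*} {G H : SimpleGraph V} (h : SwitchStep G H) :
    SwitchStep H G := by
  obtain ⟨u1, v1, u2, v2, h1, h2, h3, h4, h5, h6, a1, a2, a3, a4, rfl⟩ := h
  have key := sw_adj G u1 v1 u2 v2 h3 h4.symm
  refine ⟨u1, v2, u2, v1, h3, h2, h1, h6.symm, h5.symm, h4.symm, ?_, ?_, ?_, ?_, ?_⟩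
  · exact (key _ _).2 (by grind)
  · exact (key _ _).2 (by grind)
  · exact fun h => absurd ((key _ _).1 h) (by grind)
  · exact fun h => absurd ((key _ _).1 h) (by grind)
  · ext x y
    have k2 := sw_adj (sw G u1 v1 u2 v2) u1 v2 u2 v1 h1 h6 x y
    refine Iff.trans ?_ k2.symm
    rw [key]
    have := G.adj_comm
    grind

theorem card_swap {V : Type*} [DecidableEq V] {A B : Finset V} {p q : V}
    (hq : q ∈ A) (hp : p ∉ A) (h : ∀ y, y ∈ B ↔ (y ∈ A ∧ y ≠ q) ∨ y = p) :
    B.card = A.card := by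
  have : B = insert p (A.erase q) := by ext y; grind
  rw [this, Finset.card_insert_of_notMem (by grind), Finset.card_erase_add_one hq]

theorem dS_sw {V : Type*} (S : Finset V) (G : SimpleGraph V) {u1 v1 u2 v2 : V}
    (s1 : u1 ∈ S) (s2 : v1 ∈ S) (s3 : u2 ∈ S) (s4 : v2 ∈ S)
    (h1 : u1 ≠ v1) (h2 : u1 ≠ u2) (h3 : u1 ≠ v2) (h4 : v1 ≠ u2) (h5 : v1 ≠ v2) (h6 : u2 ≠ v2)
    (a1 : G.Adj u1 v1) (a2 : G.Adj u2 v2) (a3 : ¬ G.Adj u1 v2) (a4 : ¬ G.Adj u2 v1) (x : V) :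
    dS S (sw G u1 v1 u2 v2) x = dS S G x := by
  classical
  have key := sw_adj G u1 v1 u2 v2 h3 h4.symm
  have b1 := a1.symm
  have b2 := a2.symm
  have b3 : ¬ G.Adj v2 u1 := fun h => a3 h.symm
  have b4 : ¬ G.Adj v1 u2 := fun h => a4 h.symm
  unfold dS
  by_cases e1 : x = u1
  · subst e1
    apply card_swap (p := v2) (q := v1) <;> simp only [Finset.mem_filter, key] <;> grind
  by_cases e2 : x = v1
  · subst e2
    apply card_swap (p := u2) (q := u1) <;> simp only [Finset.mem_filter, key] <;> grind
  by_cases e3 : x = u2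
  · subst e3
    apply card_swap (p := v1) (q := v2) <;> simp only [Finset.mem_filter, key] <;> grind
  by_cases e4 : x = v2
  · subst e4
    apply card_swap (p := u1) (q := u2) <;> simp only [Finset.mem_filter, key] <;> grind
  congr 1
  ext y
  simp only [Finset.mem_filter, key]
  grind

theorem exists_w {V : Type*} (S : Finset V) (G : SimpleGraph V) {v a b : V}
    (hv : v ∈ S) (ha : a ∈ S) (hb : b ∈ S) (h1 : G.Adj v a) (h2 : ¬ G.Adj v b)
    (hvb : v ≠ b) (hd : dS S G a ≤ dS S G b) :
    ∃ w ∈ S, G.Adj w b ∧ ¬ G.Adj w a ∧ w ≠ a := by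
  classical
  by_contra! hc
  unfold dS at hd
  set A := S.filter (fun y => G.Adj a y) with hA
  set B := S.filter (fun y => G.Adj b y) with hB
  have hsub : B.erase a ⊂ A.erase b := by
    rw [Finset.ssubset_iff_of_subset]
    · refine ⟨v, ?_, ?_⟩
      · simp [hA, hv, hvb, h1.symm]
      · have : ¬ G.Adj b v := fun h => h2 h.symm
        simp [hB, this]
    · intro y hy
      simp only [hA, hB, Finset.mem_erase, Finset.mem_filter] at hy ⊢
      refine ⟨hy.2.2.ne', hy.2.1, ?_⟩
      by_contra hn
      exact hy.1 (hc y hy.2.1 hy.2.2.symm (fun h => hn h.symm))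
  have hlt := Finset.card_lt_card hsub
  by_cases hab : G.Adj a b
  · have m1 : b ∈ A := by simp [hA, hb, hab]
    have m2 : a ∈ B := by simp [hB, ha, hab.symm]
    rw [Finset.card_erase_of_mem m1, Finset.card_erase_of_mem m2] at hlt
    omega
  · have m1 : b ∉ A := by simp [hA, hab]
    have m2 : a ∉ B := by simp [hB, G.adj_comm b a, hab]
    rw [Finset.erase_eq_of_notMem m1, Finset.erase_eq_of_notMem m2] at hlt
    omega

theorem step {V : Type*} (S : Finset V) (G : SimpleGraph V) {v a b : V}
    (hv : v ∈ S) (ha : a ∈ S) (hb : b ∈ S) (h1 : G.Adj v a) (h2 : ¬ G.Adj v b)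
    (hvb : v ≠ b) (hd : dS S G a ≤ dS S G b) :
    ∃ G', SwitchStep G G' ∧ (∀ x y, x ∉ S → (G'.Adj x y ↔ G.Adj x y)) ∧
      (∀ x, dS S G' x = dS S G x) ∧ ∀ y, G'.Adj v y ↔ ((G.Adj v y ∧ y ≠ a) ∨ y = b) := by
  obtain ⟨w, hw, w1, w2, w3⟩ := exists_w S G hv ha hb h1 h2 hvb hd
  have n1 : v ≠ a := h1.ne
  have n2 : v ≠ w := by rintro rfl; exact h2 w1
  have n3 : a ≠ b := by rintro rfl; exact h2 h1
  have n4 : w ≠ b := w1.ne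
  have key := sw_adj G v a w b hvb w3
  refine ⟨sw G v a w b, ⟨v, a, w, b, n1, n2, hvb, w3.symm, n3, n4, h1, w1, h2, w2, rfl⟩, ?_,
    dS_sw S G hv ha hw hb n1 n2 hvb w3.symm n3 n4 h1 w1 h2 w2, ?_⟩
  · intro x y hx
    rw [key]
    grind
  · intro y
    rw [key]
    grind

theorem exists_ab {V : Type*} (S : Finset V) (G H : SimpleGraph V) {v : V}
    (hd : dS S G v = dS S H v) (hne : ¬ ∀ y ∈ S, (G.Adj v y ↔ H.Adj v y)) :
    ∃ a ∈ S, ∃ b ∈ S, G.Adj v a ∧ ¬ H.Adj v a ∧ H.Adj v b ∧ ¬ G.Adj v b := by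
  classical
  unfold dS at hd
  have p1 : ¬ (S.filter (fun y => G.Adj v y) ⊆ S.filter (fun y => H.Adj v y)) := by
    intro h
    have := Finset.eq_of_subset_of_card_le h hd.ge
    apply hne
    intro y hy
    have := Finset.ext_iff.1 this y
    simpa [hy] using this
  have p2 : ¬ (S.filter (fun y => H.Adj v y) ⊆ S.filter (fun y => G.Adj v y)) := by
    intro h
    have := Finset.eq_of_subset_of_card_le h hd.le
    apply hne
    intro y hy
    have := Finset.ext_iff.1 this y
    simpa [hy] using this.symm
  rw [Finset.not_subset] at p1 p2
  obtain ⟨a, h1, h2⟩ := p1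
  obtain ⟨b, h3, h4⟩ := p2
  simp only [Finset.mem_filter] at h1 h2 h3 h4
  exact ⟨a, h1.1, b, h3.1, h1.2, fun h => h2 ⟨h1.1, h⟩, h3.2, fun h => h4 ⟨h3.1, h⟩⟩

open Classical in
theorem main_aux {V : Type*} (S : Finset V) (v : V) (hv : v ∈ S)
    (IH : ∀ G H : SimpleGraph V, (∀ x y, x ∉ S.erase v → (G.Adj x y ↔ H.Adj x y)) →
      (∀ x ∈ S.erase v, dS (S.erase v) G x = dS (S.erase v) H x) →
      Relation.ReflTransGen SwitchStep G H) (n : ℕ) :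
    ∀ G H : SimpleGraph V, (∀ x y, x ∉ S → (G.Adj x y ↔ H.Adj x y)) →
      (∀ x ∈ S, dS S G x = dS S H x) →
      (S.filter (fun y => ¬ (G.Adj v y ↔ H.Adj v y))).card = n →
      Relation.ReflTransGen SwitchStep G H := by
  induction n using Nat.strong_induction_on with
  | _ n ih =>
  intro G H hag hdeg hn
  by_cases hne : ∀ y ∈ S, (G.Adj v y ↔ H.Adj v y)
  · have hvv : ∀ y, G.Adj v y ↔ H.Adj v y := by
      intro y
      by_cases hy : y ∈ S
      · exact hne y hy
      · rw [G.adj_comm, H.adj_comm]; exact hag y v hy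
    apply IH
    · intro x y hx
      by_cases hxv : x = v
      · subst hxv; exact hvv y
      · exact hag x y (by simpa [hxv] using hx)
    · intro x hx
      have := hdeg x (Finset.mem_of_mem_erase hx)
      unfold dS at this ⊢
      rw [Finset.filter_erase, Finset.filter_erase, Finset.card_erase_eq_ite,
        Finset.card_erase_eq_ite, this]
      have h2 : G.Adj x v ↔ H.Adj x v := by rw [G.adj_comm, H.adj_comm]; exact hvv x
      simp only [Finset.mem_filter, h2]
  · obtain ⟨a, ha, b, hb, g1, g2, g3, g4⟩ := exists_ab S G H (hdeg v hv) hne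
    have nb : v ≠ b := g3.ne
    have na : v ≠ a := g1.ne
    rcases le_total (dS S G a) (dS S G b) with hle | hle
    · obtain ⟨G', s1, s2, s3, s4⟩ := step S G hv ha hb g1 g4 nb hle
      refine Relation.ReflTransGen.head s1 (ih _ ?_ G' H ?_ ?_ rfl)
      · rw [← hn]
        apply Finset.card_lt_card
        rw [Finset.ssubset_iff_of_subset]
        · exact ⟨b, by simp [hb, g3, g4], by simp [s4, g3]⟩
        · intro y
          simp only [Finset.mem_filter, s4]
          grind
      · intro x y hx
        rw [s2 x y hx, hag x y hx]
      · intro x hx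
        rw [s3, hdeg x hx]
    · rw [hdeg a ha, hdeg b hb] at hle
      obtain ⟨H', s1, s2, s3, s4⟩ := step S H hv hb ha g3 g2 na hle
      refine Relation.ReflTransGen.tail (ih _ ?_ G H' ?_ ?_ rfl) s1.symm'
      · rw [← hn]
        apply Finset.card_lt_card
        rw [Finset.ssubset_iff_of_subset]
        · exact ⟨a, by simp [ha, g1, g2], by simp [s4, g1]⟩
        · intro y
          simp only [Finset.mem_filter, s4]
          grind
      · intro x y hx
        rw [s2 x y hx, hag x y hx]
      · intro x hx
        rw [s3, hdeg x hx]

theorem main_ind {V : Type*} (n : ℕ) : ∀ (S : Finset V), S.card = n → 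
    ∀ G H : SimpleGraph V, (∀ x y, x ∉ S → (G.Adj x y ↔ H.Adj x y)) →
      (∀ x ∈ S, dS S G x = dS S H x) → Relation.ReflTransGen SwitchStep G H := by
  classical
  induction n with
  | zero =>
    intro S hS G H hag _
    rw [Finset.card_eq_zero] at hS
    subst hS
    have : G = H := by ext x y; exact hag x y (by simp)
    rw [this]
  | succ n ih =>
    intro S hS G H hag hdeg
    obtain ⟨v, hv⟩ : S.Nonempty := by rw [← Finset.card_pos]; omega
    refine main_aux S v hv (fun G H => ?_) _ G H hag hdeg rfl
    have := ih (S.erase v) (by rw [Finset.card_erase_of_mem hv]; omega) G H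
    convert this

theorem switch_chain_irreducible {V : Type*} [Fintype V]
    (G H : SimpleGraph V)
    (hdeg : ∀ v : V, (G.neighborSet v).ncard = (H.neighborSet v).ncard) :
    Relation.ReflTransGen SwitchStep G H := by
  classical
  refine main_ind _ Finset.univ rfl G H (by simp) ?_
  have key : ∀ (K : SimpleGraph V) x, dS Finset.univ K x = (K.neighborSet x).ncard := by
    intro K x
    unfold dS
    rw [← Set.ncard_coe_finset]
    congr 1
    ext y
    simp
  intro x _
  rw [key, key, hdeg]
end
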